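/- arXiv:2410.09321 — 2 statements merged into one kernel-verified Lean document; each statement's English description precedes it below -/
import Mathlib

section
/- For every correlation clustering instance G=(V,E) with |V|=n there exists a single clustering 𝒞 of V that is simultaneously a 63.3-approximation for the family of all monotone symmetric norms: for every monotone symmetric norm f:ℝ^n_{≥0}→ℝ_{≥0}, f(cost_𝒞) ≤ 63.3 · f(cost_{OPT_f}), where OPT_f is a clustering minimizing f of the disagreement vector. -/
open Finset

attribute [local instance] Classical.propDecidable

noncomputable section

variable {V : Type*}

/-- The neighborhood of `u` in the graph of `+`edges `E` (contains `u` itself,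
since `E` contains all self-loops). -/
def Nbr [Fintype V] (E : V → V → Prop) (u : V) : Finset V :=
  Finset.univ.filter (fun v => E u v)

/-- The degree `d(u) = |N(u)|`. -/
def deg [Fintype V] (E : V → V → Prop) (u : V) : ℕ := (Nbr E u).card

/-- `M_{uv} = max (d(u), d(v))`. -/
def Mdeg [Fintype V] (E : V → V → Prop) (u v : V) : ℕ := max (deg E u) (deg E v)

/-- The pruned edge set `E_H = {uv ∈ E : |N(u) Δ N(v)| ≤ β · M_{uv}}`. -/
def EH [Fintype V] (β : ℝ) (E : V → V → Prop) (u v : V) : Prop :=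
  E u v ∧ ((symmDiff (Nbr E u) (Nbr E v)).card : ℝ) ≤ β * (Mdeg E u v : ℝ)

/-- The neighborhood of `u` in the pruned graph `H`. -/
def NH [Fintype V] (β : ℝ) (E : V → V → Prop) (u : V) : Finset V :=
  Finset.univ.filter (fun v => EH β E u v)

/-- The fractional solution: `x_{uu} = 0` and
`x_{uv} = 1 − |N_H(u) ∩ N_H(v)| / M_{uv}` for `u ≠ v`. -/
def xval [Fintype V] (β : ℝ) (E : V → V → Prop) (u v : V) : ℝ :=
  if u = v then 0 else 1 - ((NH β E u ∩ NH β E v).card : ℝ) / (Mdeg E u v : ℝ)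

/-- `cost_𝒞(u)`: the number of pairs incident to `u` in disagreement with respect
to the clustering `C` (given as a labelling function). -/
def costC [Fintype V] {α : Type*} (E : V → V → Prop) (C : V → α) (u : V) : ℕ :=
  (Finset.univ.filter
    (fun v => (E u v ∧ C u ≠ C v) ∨ (¬ E u v ∧ v ≠ u ∧ C u = C v))).card

/-- The top-`k` norm `cost^k_𝒞` of the disagreement vector of the clustering `C`:
the maximum of `∑_{u ∈ T} cost_𝒞(u)` over subsets `T ⊆ V` of size `k`. -/
def costTopK [Fintype V] {α : Type*} (E : V → V → Prop) (C : V → α) (k : ℕ) : ℕ :=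
  (Finset.powersetCard k (Finset.univ : Finset V)).sup (fun T => ∑ u ∈ T, costC E C u)

/-- A monotone symmetric norm on the nonnegative orthant of `ι → ℝ`:
it is nonnegative, positively homogeneous, subadditive, monotone, and invariant
under coordinate permutations (all conditions imposed on nonnegative vectors). -/
structure IsMonoSymNorm {ι : Type*} (f : (ι → ℝ) → ℝ) : Prop where
  nonneg : ∀ x : ι → ℝ, (∀ i, 0 ≤ x i) → 0 ≤ f x
  homog : ∀ (a : ℝ), 0 ≤ a → ∀ x : ι → ℝ, (∀ i, 0 ≤ x i) →
    f (fun i => a * x i) = a * f x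
  subadd : ∀ x y : ι → ℝ, (∀ i, 0 ≤ x i) → (∀ i, 0 ≤ y i) →
    f (fun i => x i + y i) ≤ f x + f y
  mono : ∀ x y : ι → ℝ, (∀ i, 0 ≤ x i) → (∀ i, x i ≤ y i) → f x ≤ f y
  symm : ∀ (σ : Equiv.Perm ι) (x : ι → ℝ), (∀ i, 0 ≤ x i) → f (fun i => x (σ i)) = f x

/-- The profit of a settled pair when the vertex is far from, or close to, the pivot. -/
theorem profit_nonneg {a b c : ℝ} {e s : Prop} [Decidable e] [Decidable s]
    (hb : 0 ≤ b) (hb1 : b ≤ 1)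
    (t1 : c ≤ a + b) (t2 : b ≤ a + c) (t3 : a ≤ c + b)
    (hs : a ≤ 2/5 → (s ↔ c ≤ 2/5)) (hs' : ¬ a ≤ 2/5 → c ≤ 2/5 → ¬ s)
    (ha : a ≤ 1/5 ∨ 3/5 < a) :
    0 ≤ if a ≤ 2/5 ∨ c ≤ 2/5 then
      5 * (if e then b else 1 - b) - (if (e ∧ ¬ s) ∨ (¬ e ∧ s) then (1 : ℝ) else 0) else 0 := by
  by_cases h1 : a ≤ 2/5 <;> by_cases h2 : c ≤ 2/5 <;> by_cases he : e <;>
    rcases ha with ha | ha <;> simp [h1, h2] at hs hs' <;> simp [h1, h2, he, hs, hs'] <;>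
    linarith

/-- The profit of a settled pair when the vertex is at middle distance from the pivot. -/
theorem profit_ge_of_mid {a b c : ℝ} {e s : Prop} [Decidable e] [Decidable s]
    (hb1 : b ≤ 1) (hc : 0 ≤ c)
    (t2 : b ≤ a + c) (t3 : a ≤ c + b)
    (hs : a ≤ 2/5 → (s ↔ c ≤ 2/5)) (hs' : ¬ a ≤ 2/5 → c ≤ 2/5 → ¬ s)
    (ha' : a ≤ 3/5) :
    5 * (if c ≤ 1/5 then 1/5 - c else 0) - 5 * (if b ≤ 1/5 then 1/5 - b else 0) ≤
    if a ≤ 2/5 ∨ c ≤ 2/5 then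
      5 * (if e then b else 1 - b) - (if (e ∧ ¬ s) ∨ (¬ e ∧ s) then (1 : ℝ) else 0) else 0 := by
  by_cases h1 : a ≤ 2/5 <;> by_cases h2 : c ≤ 2/5 <;> by_cases he : e <;>
    simp only [h1, h2, true_imp_iff, false_imp_iff, not_true, not_false_iff, iff_true,
      iff_false] at hs hs' <;>
    simp only [h1, h2, he, hs, hs', or_true, or_self, if_true, if_false, not_true,
      not_false_iff, and_true, and_false, or_false] <;>
    split_ifs <;> linarith

/-- Threshold clustering around a vertex of maximal local mass rounds a `[0,1]`-valued
pseudometric into a clustering whose cost at every vertex is at most five times the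
fractional cost. -/
theorem exists_rounding_on [Fintype V] (E : V → V → Prop) (x : V → V → ℝ)
    (x_self : ∀ u, x u u = 0) (x_comm : ∀ u v, x u v = x v u)
    (x_nonneg : ∀ u v, 0 ≤ x u v) (x_le : ∀ u v, x u v ≤ 1)
    (x_tri : ∀ u v w, x u w ≤ x u v + x v w) (hrefl : ∀ u, E u u) (n : ℕ) :
    ∀ S : Finset V, S.card ≤ n → ∃ C : V → ℕ, ∀ u ∈ S,
      ∑ v ∈ S, (if (E u v ∧ C u ≠ C v) ∨ (¬ E u v ∧ v ≠ u ∧ C u = C v) then (1 : ℝ) else 0)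
        ≤ 5 * ∑ v ∈ S, (if E u v then x u v else 1 - x u v) := by
  induction n with
  | zero =>
    intro S hS
    have : S = ∅ := by simpa using hS
    exact ⟨fun _ => 0, by simp [this]⟩
  | succ n ih =>
    intro S hS
    rcases S.eq_empty_or_nonempty with rfl | hne
    · exact ⟨fun _ => 0, by simp⟩
    let L : V → ℝ := fun w => ∑ v ∈ S, (if x w v ≤ 1/5 then 1/5 - x w v else 0)
    obtain ⟨w, hwS, hw⟩ := S.exists_max_image L hne
    obtain ⟨C', hC'⟩ := ih (S.filter (fun v => ¬ x w v ≤ 2/5)) (by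
      have : (S.filter (fun v => ¬ x w v ≤ 2/5)).card < S.card := by
        refine Finset.card_lt_card (Finset.filter_ssubset.2 ⟨w, hwS, ?_⟩)
        rw [x_self]; norm_num
      omega)
    let C : V → ℕ := fun v => if x w v ≤ 2/5 then 0 else C' v + 1
    refine ⟨C, fun u hu => ?_⟩
    -- the profit of the pairs settled with the new cluster
    let settled : V → Prop := fun v => x w u ≤ 2/5 ∨ x w v ≤ 2/5
    let g : V → ℝ := fun v => 5 * (if E u v then x u v else 1 - x u v) -
      (if (E u v ∧ C u ≠ C v) ∨ (¬ E u v ∧ v ≠ u ∧ C u = C v) then (1 : ℝ) else 0)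
    have key : 0 ≤ ∑ v ∈ S, if settled v then g v else 0 := by
      have agree : ∀ v, x w u ≤ 2/5 → (C u = C v ↔ x w v ≤ 2/5) := by
        intro v h1; by_cases h2 : x w v ≤ 2/5 <;> simp [C, h1, h2]
      have agree' : ∀ v, ¬ x w u ≤ 2/5 → x w v ≤ 2/5 → ¬ C u = C v := by
        intro v h1 h2; simp [C, h1, h2]
      have hg : ∀ v, g v = 5 * (if E u v then x u v else 1 - x u v) -
          (if (E u v ∧ ¬ C u = C v) ∨ (¬ E u v ∧ C u = C v) then (1 : ℝ) else 0) := by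
        intro v
        have : ¬ E u v → v ≠ u := by rintro h rfl; exact h (hrefl v)
        simp only [g]
        congr 2
        simp only [eq_iff_iff]
        tauto
      by_cases hmid : 1/5 < x w u ∧ x w u ≤ 3/5
      · have hL : L u ≤ L w := hw u hu
        have : ∀ v ∈ S, 5 * (if x w v ≤ 1/5 then 1/5 - x w v else 0)
            - 5 * (if x u v ≤ 1/5 then 1/5 - x u v else 0)
            ≤ if settled v then g v else 0 := by
          intro v _
          rw [hg]
          exact profit_ge_of_mid (x_le u v) (x_nonneg w v)
            ((x_tri u w v).trans_eq (by rw [x_comm u w]))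
            ((x_tri w v u).trans_eq (by rw [x_comm u v])) (agree v) (agree' v) hmid.2
        calc (0:ℝ) ≤ 5 * L w - 5 * L u := by linarith
          _ = _ := by
            simp only [L]
            rw [Finset.mul_sum, Finset.mul_sum, ← Finset.sum_sub_distrib]
          _ ≤ _ := Finset.sum_le_sum this
      · refine Finset.sum_nonneg fun v _ => ?_
        rw [hg]
        refine profit_nonneg (x_nonneg u v) (x_le u v) (x_tri w u v)
            ((x_tri u w v).trans_eq (by rw [x_comm u w]))
            ((x_tri w v u).trans_eq (by rw [x_comm u v])) (agree v) (agree' v) ?_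
        by_contra! h; exact hmid ⟨h.1, h.2⟩
    have total : 0 ≤ ∑ v ∈ S, g v := by
      by_cases h1 : x w u ≤ 2/5
      · simpa [settled, h1] using key
      · have rest : 0 ≤ ∑ v ∈ S, if settled v then 0 else g v := by
          have hu' : u ∈ S.filter (fun v => ¬ x w v ≤ 2/5) := by simp [hu]; linarith
          have h := hC' u hu'
          have e : (∑ v ∈ S, if settled v then 0 else g v)
              = ∑ v ∈ S.filter (fun v => ¬ x w v ≤ 2/5),
                (5 * (if E u v then x u v else 1 - x u v) -
                (if (E u v ∧ C' u ≠ C' v) ∨ (¬ E u v ∧ v ≠ u ∧ C' u = C' v)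
                  then (1 : ℝ) else 0)) := by
            rw [Finset.sum_filter]
            refine Finset.sum_congr rfl fun v _ => ?_
            by_cases h2 : x w v ≤ 2/5 <;> simp [settled, g, C, h1, h2]
          rw [e, Finset.sum_sub_distrib, ← Finset.mul_sum]
          linarith
        have e : ∑ v ∈ S, g v = (∑ v ∈ S, if settled v then g v else 0)
            + ∑ v ∈ S, if settled v then 0 else g v := by
          rw [← Finset.sum_add_distrib]
          refine Finset.sum_congr rfl fun v _ => ?_
          split_ifs <;> simp
        rw [e]; exact add_nonneg key rest
    simp only [g] at total
    rw [Finset.sum_sub_distrib, ← Finset.mul_sum] at total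
    linarith

/-- The rounding theorem for the whole vertex set, phrased with `costC`. -/
theorem exists_rounding [Fintype V] (E : V → V → Prop) (x : V → V → ℝ)
    (x_self : ∀ u, x u u = 0) (x_comm : ∀ u v, x u v = x v u)
    (x_nonneg : ∀ u v, 0 ≤ x u v) (x_le : ∀ u v, x u v ≤ 1)
    (x_tri : ∀ u v w, x u w ≤ x u v + x v w) (hrefl : ∀ u, E u u) :
    ∃ C : V → ℕ, ∀ u,
      (costC E C u : ℝ) ≤ 5 * ∑ v, (if E u v then x u v else 1 - x u v) := by
  obtain ⟨C, hC⟩ := exists_rounding_on E x x_self x_comm x_nonneg x_le x_tri hrefl _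
    Finset.univ le_rfl
  refine ⟨C, fun u => ?_⟩
  have h := hC u (Finset.mem_univ u)
  simp only [costC, Finset.natCast_card_filter]
  convert h

theorem IsMonoSymNorm.map_sum_le {ι κ : Type*} {f : (ι → ℝ) → ℝ} (hf : IsMonoSymNorm f)
    (s : Finset κ) (g : κ → ι → ℝ) (hg : ∀ k i, 0 ≤ g k i) :
    f (fun i => ∑ k ∈ s, g k i) ≤ ∑ k ∈ s, f (g k) := by
  induction s using Finset.induction_on with
  | empty =>
    have h := hf.homog 0 le_rfl (fun _ => 0) (fun _ => le_rfl)
    simp only [zero_mul] at h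
    simp [h]
  | insert a s ha ih =>
    simp only [Finset.sum_insert ha]
    have h := hf.subadd (g a) (fun i => ∑ k ∈ s, g k i) (hg a)
      (fun i => Finset.sum_nonneg fun k _ => hg k i)
    linarith

/-- A nonnegative square matrix whose row and column sums are at most one is dominated
entrywise by a doubly stochastic matrix. -/
theorem exists_doublyStochastic_ge [Fintype V] (A : V → V → ℝ)
    (A_row : ∀ u, ∑ w, A u w ≤ 1) (A_col : ∀ w, ∑ u, A u w ≤ 1) (A_nonneg : ∀ u w, 0 ≤ A u w) :
    ∃ B ∈ doublyStochastic ℝ V, ∀ u w, A u w ≤ B u w := by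
  let r : V → ℝ := fun u => 1 - ∑ w, A u w
  let c : V → ℝ := fun w => 1 - ∑ u, A u w
  have hr : ∀ u, 0 ≤ r u := fun u => sub_nonneg.2 (A_row u)
  have hc : ∀ u, 0 ≤ c u := fun u => sub_nonneg.2 (A_col u)
  have hrc : ∑ u, r u = ∑ w, c w := by
    simp only [r, c, Finset.sum_sub_distrib]
    rw [Finset.sum_comm]
  by_cases hm : ∑ u, r u = 0
  · refine ⟨Matrix.of A, ?_, fun _ _ => le_rfl⟩
    simp only [mem_doublyStochastic_iff_sum, Matrix.of_apply]
    have h1 := (Finset.sum_eq_zero_iff_of_nonneg fun u _ => hr u).1 hm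
    have h2 := (Finset.sum_eq_zero_iff_of_nonneg fun u _ => hc u).1 (hrc ▸ hm)
    refine ⟨A_nonneg, fun u => ?_, fun w => ?_⟩
    · have := h1 u (Finset.mem_univ u); simp only [r] at this; linarith
    · have := h2 w (Finset.mem_univ w); simp only [c] at this; linarith
  · have extra : ∀ u w, 0 ≤ r u * c w / ∑ u, r u := fun u w =>
      div_nonneg (mul_nonneg (hr u) (hc w)) (Finset.sum_nonneg fun u _ => hr u)
    refine ⟨Matrix.of fun u w => A u w + r u * c w / ∑ u, r u, ?_, fun u w => ?_⟩
    swap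
    · simpa using extra u w
    simp only [mem_doublyStochastic_iff_sum, Matrix.of_apply]
    refine ⟨fun u w => add_nonneg (A_nonneg u w) (extra u w), fun u => ?_, fun w => ?_⟩
    · rw [Finset.sum_add_distrib, ← Finset.sum_div, ← Finset.mul_sum, ← hrc,
        mul_div_cancel_right₀ _ hm]
      simp [r]
    · rw [Finset.sum_add_distrib, ← Finset.sum_div, ← Finset.sum_mul,
        mul_div_cancel_left₀ _ hm]
      simp [c]

/-- A monotone symmetric norm grows by a factor of at most `c` under a nonnegative matrix
whose row and column sums are at most `c`. -/
theorem IsMonoSymNorm.map_le_of_row_col_sum_le [Fintype V] {f : (V → ℝ) → ℝ}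
    (hf : IsMonoSymNorm f) {c : ℝ} (hc : 0 < c) (A : V → V → ℝ) (A_nonneg : ∀ u w, 0 ≤ A u w)
    (A_row : ∀ u, ∑ w, A u w ≤ c) (A_col : ∀ w, ∑ u, A u w ≤ c) (a b : V → ℝ)
    (ha : ∀ u, 0 ≤ a u) (hb : ∀ u, 0 ≤ b u) (hab : ∀ u, a u ≤ ∑ w, A u w * b w) :
    f a ≤ c * f b := by
  obtain ⟨B, hB, hAB⟩ := exists_doublyStochastic_ge (fun u w => A u w / c)
    (fun u => by rw [← Finset.sum_div, div_le_one hc]; exact A_row u)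
    (fun u => by rw [← Finset.sum_div, div_le_one hc]; exact A_col u)
    (fun u w => div_nonneg (A_nonneg u w) hc.le)
  obtain ⟨wt, wt_nonneg, wt_sum, rfl⟩ := exists_eq_sum_perm_of_mem_doublyStochastic hB
  let g : Equiv.Perm V → V → ℝ := fun σ u => wt σ * b (σ u)
  have hg : ∀ σ u, 0 ≤ g σ u := fun σ u => mul_nonneg (wt_nonneg σ) (hb _)
  have hle : ∀ u, a u ≤ c * ∑ σ, g σ u := by
    intro u
    refine (hab u).trans ?_
    have e : ∑ σ, g σ u = ∑ w, (∑ σ, wt σ • σ.permMatrix ℝ : Matrix V V ℝ) u w * b w := by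
      simp only [Matrix.sum_apply, Finset.sum_mul]
      rw [Finset.sum_comm]
      refine Finset.sum_congr rfl fun σ _ => ?_
      simp [g, Equiv.Perm.permMatrix, PEquiv.toMatrix_apply, Equiv.toPEquiv_apply]
    rw [e, Finset.mul_sum]
    refine Finset.sum_le_sum fun w _ => ?_
    have h := hAB u w
    rw [div_le_iff₀ hc] at h
    calc _ ≤ _ := mul_le_mul_of_nonneg_right h (hb w)
      _ = _ := by ring
  have hsum : ∀ u, 0 ≤ ∑ σ, g σ u := fun u => Finset.sum_nonneg fun σ _ => hg σ u
  calc f a ≤ f (fun u => c * ∑ σ, g σ u) := hf.mono _ _ ha hle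
    _ = c * f (fun u => ∑ σ, g σ u) := hf.homog c hc.le _ hsum
    _ ≤ c * ∑ σ, f (g σ) := by gcongr; exact hf.map_sum_le _ _ hg
    _ = c * ∑ σ, wt σ * f b := by
      congr 1
      refine Finset.sum_congr rfl fun σ _ => ?_
      rw [← hf.symm σ b hb]
      exact hf.homog _ (wt_nonneg σ) _ fun u => hb _
    _ = c * f b := by rw [← Finset.sum_mul, wt_sum, one_mul]

section Fractional

variable {α : Type*} [Fintype V] {β : ℝ} {E : V → V → Prop} {D : V → α}

theorem mem_Nbr {u v : V} : v ∈ Nbr E u ↔ E u v := by simp [Nbr]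

theorem mem_NH {u v : V} : v ∈ NH β E u ↔ EH β E u v := by simp [NH]

theorem NH_subset_Nbr (u : V) : NH β E u ⊆ Nbr E u := fun _ hv =>
  mem_Nbr.2 (mem_NH.1 hv).1

theorem deg_pos (hrefl : ∀ u, E u u) (u : V) : 0 < deg E u :=
  Finset.card_pos.2 ⟨u, mem_Nbr.2 (hrefl u)⟩

theorem Mdeg_comm (u v : V) : Mdeg E u v = Mdeg E v u := max_comm _ _

theorem Mdeg_pos (hrefl : ∀ u, E u u) (u v : V) : (0 : ℝ) < Mdeg E u v :=
  Nat.cast_pos.2 ((deg_pos hrefl u).trans_le (le_max_left _ _))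

theorem EH_symm (hsymm : ∀ u v, E u v → E v u) {u v : V} (h : EH β E u v) : EH β E v u :=
  ⟨hsymm _ _ h.1, by rw [symmDiff_comm, Mdeg_comm]; exact h.2⟩

theorem inv_Mdeg_le_left (hrefl : ∀ u, E u u) (u v : V) :
    (Mdeg E u v : ℝ)⁻¹ ≤ (deg E u : ℝ)⁻¹ :=
  inv_anti₀ (Nat.cast_pos.2 (deg_pos hrefl u)) (Nat.cast_le.2 (le_max_left _ _))

theorem xval_self (u : V) : xval β E u u = 0 := by simp [xval]

theorem xval_comm (u v : V) : xval β E u v = xval β E v u := by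
  simp only [xval, Mdeg_comm u v, Finset.inter_comm (NH β E u), eq_comm (a := u)]

theorem xval_le_one (u v : V) : xval β E u v ≤ 1 := by
  unfold xval
  split_ifs
  · exact zero_le_one
  · have : (0 : ℝ) ≤ ((NH β E u ∩ NH β E v).card : ℝ) / (Mdeg E u v : ℝ) := by positivity
    linarith

theorem card_inter_le_Mdeg (u v : V) : (NH β E u ∩ NH β E v).card ≤ Mdeg E u v :=
  (Finset.card_le_card (Finset.inter_subset_left.trans (NH_subset_Nbr u))).trans
    (le_max_left _ _)

theorem xval_nonneg (u v : V) : 0 ≤ xval β E u v := by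
  unfold xval
  split_ifs
  · exact le_rfl
  · rw [sub_nonneg]
    exact div_le_one_of_le₀ (Nat.cast_le.2 (card_inter_le_Mdeg u v)) (Nat.cast_nonneg _)

theorem card_inter_add_card_inter_le (u v w : V) :
    (NH β E u ∩ NH β E v).card + (NH β E v ∩ NH β E w).card
      ≤ deg E v + (NH β E u ∩ NH β E w).card := by
  rw [← Finset.card_union_add_card_inter]
  refine add_le_add (Finset.card_le_card (Finset.union_subset ?_ ?_))
    (Finset.card_le_card ?_)
  · exact Finset.inter_subset_right.trans (NH_subset_Nbr v)
  · exact Finset.inter_subset_left.trans (NH_subset_Nbr v)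
  · intro z hz
    simp only [Finset.mem_inter] at hz ⊢
    exact ⟨hz.1.1, hz.2.2⟩

/-- Triangle inequality for one minus the ratio of common neighbors to maximal degree. -/
theorem agreement_triangle {d₁ d₂ d₃ a₁₂ a₂₃ a₁₃ : ℝ} (h₁ : 0 < d₁) (h₂ : 0 < d₂)
    (b₁₂ : a₁₂ ≤ max d₁ d₂) (b₂₃ : a₂₃ ≤ max d₂ d₃) (b₁₃ : 0 ≤ a₁₃)
    (h : a₁₂ + a₂₃ ≤ d₂ + a₁₃) :
    1 - a₁₃ / max d₁ d₃ ≤ (1 - a₁₂ / max d₁ d₂) + (1 - a₂₃ / max d₂ d₃) := by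
  have m₁₂ : 0 < max d₁ d₂ := lt_max_of_lt_left h₁
  have m₂₃ : 0 < max d₂ d₃ := lt_max_of_lt_left h₂
  have m₁₃ : 0 < max d₁ d₃ := lt_max_of_lt_left h₁
  have e₁₂ : 1 - a₁₂ / max d₁ d₂ = (max d₁ d₂ - a₁₂) / max d₁ d₂ := by field_simp
  have e₂₃ : 1 - a₂₃ / max d₂ d₃ = (max d₂ d₃ - a₂₃) / max d₂ d₃ := by field_simp
  have e₁₃ : 1 - a₁₃ / max d₁ d₃ = (max d₁ d₃ - a₁₃) / max d₁ d₃ := by field_simp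
  -- compare every denominator with the largest degree
  set m := max (max d₁ d₂) d₃ with hm
  have hm0 : 0 < m := lt_max_of_lt_left m₁₂
  have le₁₂ : max d₁ d₂ ≤ m := le_max_left _ _
  have le₂₃ : max d₂ d₃ ≤ m :=
    max_le ((le_max_right _ _).trans (le_max_left _ _)) (le_max_right _ _)
  have le₁₃ : max d₁ d₃ ≤ m :=
    max_le ((le_max_left _ _).trans (le_max_left _ _)) (le_max_right _ _)
  have k₁₂ : (max d₁ d₂ - a₁₂) / m ≤ 1 - a₁₂ / max d₁ d₂ := by
    rw [e₁₂]; exact div_le_div_of_nonneg_left (by linarith) m₁₂ le₁₂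
  have k₂₃ : (max d₂ d₃ - a₂₃) / m ≤ 1 - a₂₃ / max d₂ d₃ := by
    rw [e₂₃]; exact div_le_div_of_nonneg_left (by linarith) m₂₃ le₂₃
  have k₁₃ : 1 - a₁₃ / max d₁ d₃ ≤ 1 - a₁₃ / m := by
    have := div_le_div_of_nonneg_left b₁₃ m₁₃ le₁₃
    linarith
  have fin : m - a₁₃ ≤ (max d₁ d₂ - a₁₂) + (max d₂ d₃ - a₂₃) := by
    have : m + d₂ ≤ max d₁ d₂ + max d₂ d₃ := by
      rcases max_cases (max d₁ d₂) d₃ with ⟨h, _⟩ | ⟨h, _⟩ <;> rw [hm, h]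
      · linarith [le_max_left d₂ d₃]
      · linarith [le_max_right d₂ d₃, le_max_right d₁ d₂]
    linarith
  calc _ ≤ 1 - a₁₃ / m := k₁₃
    _ = (m - a₁₃) / m := by field_simp
    _ ≤ ((max d₁ d₂ - a₁₂) + (max d₂ d₃ - a₂₃)) / m := by gcongr
    _ = (max d₁ d₂ - a₁₂) / m + (max d₂ d₃ - a₂₃) / m := add_div _ _ _
    _ ≤ _ := add_le_add k₁₂ k₂₃

theorem xval_triangle (hrefl : ∀ u, E u u) (u v w : V) :
    xval β E u w ≤ xval β E u v + xval β E v w := by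
  by_cases huw : u = w
  · subst huw
    rw [xval_self]
    exact add_nonneg (xval_nonneg _ _) (xval_nonneg _ _)
  by_cases huv : u = v
  · subst huv; simp [xval_self]
  by_cases hvw : v = w
  · subst hvw; simp [xval_self]
  simp only [xval, huw, huv, hvw, if_false]
  have h := card_inter_add_card_inter_le (β := β) (E := E) u v w
  have b₁ := card_inter_le_Mdeg (β := β) (E := E) u v
  have b₂ := card_inter_le_Mdeg (β := β) (E := E) v w
  simp only [Mdeg] at b₁ b₂ ⊢
  push_cast
  exact agreement_triangle (Nat.cast_pos.2 (deg_pos hrefl u)) (Nat.cast_pos.2 (deg_pos hrefl v))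
    (by exact_mod_cast b₁) (by exact_mod_cast b₂)
    (Nat.cast_nonneg _) (by exact_mod_cast h)

/-- The number of `+`edges at `u` leaving the cluster of `u`. -/
def crossDeg (E : V → V → Prop) (D : V → α) (u : V) : ℝ :=
  ∑ v, if E u v ∧ D u ≠ D v then 1 else 0

/-- The number of `−`edges at `u` inside the cluster of `u`. -/
def missDeg (E : V → V → Prop) (D : V → α) (u : V) : ℝ :=
  ∑ v, if ¬ E u v ∧ D u = D v then 1 else 0

/-- The number of `+`edges at `u` inside the cluster of `u` that are pruned from `H`. -/
def prunedDeg (β : ℝ) (E : V → V → Prop) (D : V → α) (u : V) : ℕ :=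
  (Finset.univ.filter fun v => E u v ∧ ¬ EH β E u v ∧ D u = D v).card

/-- The weight `1 / M_{uv}` on the edges of `H` inside clusters. -/
def keptWeight (β : ℝ) (E : V → V → Prop) (D : V → α) (u v : V) : ℝ :=
  if EH β E u v ∧ D u = D v then (Mdeg E u v : ℝ)⁻¹ else 0

/-- The weight `1 / M_{uv}` on the pruned edges inside clusters. -/
def prunedWeight (β : ℝ) (E : V → V → Prop) (D : V → α) (u v : V) : ℝ :=
  if E u v ∧ ¬ EH β E u v ∧ D u = D v then (Mdeg E u v : ℝ)⁻¹ else 0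

/-- The total weight of the bad triangles `u, w, v` in which only `wv` disagrees. -/
def triangleWeight (β : ℝ) (E : V → V → Prop) (D : V → α) (u w : V) : ℝ :=
  ∑ v, if EH β E u w ∧ EH β E w v ∧ ¬ E u v ∧ D u = D w ∧ D w ≠ D v
    then (Mdeg E u v : ℝ)⁻¹ else 0

theorem keptWeight_nonneg (u v : V) : 0 ≤ keptWeight β E D u v := by
  unfold keptWeight; positivity

theorem prunedWeight_nonneg (u v : V) : 0 ≤ prunedWeight β E D u v := by
  unfold prunedWeight; positivity

theorem triangleWeight_nonneg (u v : V) : 0 ≤ triangleWeight β E D u v := by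
  unfold triangleWeight; positivity

theorem keptWeight_comm (hsymm : ∀ u v, E u v → E v u) (u v : V) :
    keptWeight β E D u v = keptWeight β E D v u := by
  have : EH β E u v ↔ EH β E v u := ⟨EH_symm hsymm, EH_symm hsymm⟩
  simp only [keptWeight, this, eq_comm (a := D u), Mdeg_comm u v]

theorem prunedWeight_comm (hsymm : ∀ u v, E u v → E v u) (u v : V) :
    prunedWeight β E D u v = prunedWeight β E D v u := by
  have h1 : EH β E u v ↔ EH β E v u := ⟨EH_symm hsymm, EH_symm hsymm⟩
  have h2 : E u v ↔ E v u := ⟨hsymm _ _, hsymm _ _⟩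
  simp only [prunedWeight, h1, h2, eq_comm (a := D u), Mdeg_comm u v]

theorem cost_eq (hrefl : ∀ u, E u u) (u : V) :
    (costC E D u : ℝ) = crossDeg E D u + missDeg E D u := by
  simp only [costC, crossDeg, missDeg, Finset.natCast_card_filter, ← Finset.sum_add_distrib]
  refine Finset.sum_congr rfl fun v _ => ?_
  have : ¬ E u v → v ≠ u := by rintro h rfl; exact h (hrefl v)
  by_cases h1 : E u v <;> by_cases h2 : D u = D v <;> simp_all

theorem missDeg_nonneg (u : V) : 0 ≤ missDeg E D u := by unfold missDeg; positivity

theorem crossDeg_le_cost (hrefl : ∀ u, E u u) (u : V) : crossDeg E D u ≤ costC E D u := by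
  rw [cost_eq hrefl]; linarith [missDeg_nonneg (E := E) (D := D) u]

theorem card_symmDiff_le (hrefl : ∀ u, E u u) {u w : V} (h : D u = D w) :
    (symmDiff (Nbr E u) (Nbr E w)).card ≤ costC E D u + costC E D w := by
  unfold costC
  refine (Finset.card_le_card fun v hv => ?_).trans (Finset.card_union_le _ _)
  simp only [Finset.mem_symmDiff, mem_Nbr, Finset.mem_union, Finset.mem_filter,
    Finset.mem_univ, true_and] at hv ⊢
  have h1 : ¬ E u v → v ≠ u := by rintro h rfl; exact h (hrefl v)
  have h2 : ¬ E w v → v ≠ w := by rintro h rfl; exact h (hrefl v)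
  by_cases hv' : D u = D v <;> simp_all <;> tauto

theorem deg_le_card_inter_add (hrefl : ∀ u, E u u) {u v : V} (h : D u = D v) :
    deg E u ≤ (NH β E u ∩ NH β E v).card + (costC E D u + costC E D v)
      + (prunedDeg β E D u + prunedDeg β E D v) := by
  unfold costC prunedDeg deg
  refine (Finset.card_le_card fun w hw => ?_).trans <| (Finset.card_union_le _ _).trans <|
    add_le_add ((Finset.card_union_le _ _).trans <| add_le_add le_rfl (Finset.card_union_le _ _))
      (Finset.card_union_le _ _)
  simp only [Finset.mem_inter, mem_Nbr, mem_NH, Finset.mem_union, Finset.mem_filter,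
    Finset.mem_univ, true_and] at hw ⊢
  have h2 : ¬ E v w → w ≠ v := by rintro h rfl; exact h (hrefl w)
  by_cases hv' : D v = D w <;> by_cases h3 : E v w <;> simp_all
  tauto

theorem xval_le_keptWeight (hrefl : ∀ u, E u u) {u v : V} (hH : EH β E u v) (h : D u = D v) :
    xval β E u v ≤ keptWeight β E D u v *
      (costC E D u + costC E D v + (prunedDeg β E D u + prunedDeg β E D v)) := by
  have hM := Mdeg_pos hrefl u v
  have hle : Mdeg E u v ≤ (NH β E u ∩ NH β E v).card + (costC E D u + costC E D v)
      + (prunedDeg β E D u + prunedDeg β E D v) := by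
    refine max_le (deg_le_card_inter_add hrefl h) ?_
    have := deg_le_card_inter_add (β := β) hrefl h.symm
    rw [Finset.inter_comm] at this
    omega
  have hle' : (Mdeg E u v : ℝ) ≤ (NH β E u ∩ NH β E v).card + (costC E D u + costC E D v)
      + (prunedDeg β E D u + prunedDeg β E D v) := by exact_mod_cast hle
  unfold xval keptWeight
  rw [if_pos (show EH β E u v ∧ D u = D v from ⟨hH, h⟩), inv_mul_eq_div]
  split_ifs
  · positivity
  · rw [le_div_iff₀ hM, sub_mul, div_mul_cancel₀ _ hM.ne']
    linarith

theorem sum_edge_le (hrefl : ∀ u, E u u) (u : V) :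
    (∑ v, if E u v then xval β E u v else 0) ≤ crossDeg E D u + prunedDeg β E D u
      + ∑ v, keptWeight β E D u v *
        (costC E D u + costC E D v + (prunedDeg β E D u + prunedDeg β E D v)) := by
  have e : (prunedDeg β E D u : ℝ) = ∑ v, if E u v ∧ ¬ EH β E u v ∧ D u = D v then 1 else 0 := by
    simp only [prunedDeg, Finset.natCast_card_filter]
  conv_rhs => rw [e]
  unfold crossDeg
  rw [← Finset.sum_add_distrib, ← Finset.sum_add_distrib]
  refine Finset.sum_le_sum fun v _ => ?_
  rw [← e]
  have h0 : 0 ≤ keptWeight β E D u v *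
      (costC E D u + costC E D v + (prunedDeg β E D u + prunedDeg β E D v)) :=
    mul_nonneg (keptWeight_nonneg u v) (by positivity)
  have h1 := xval_le_one (β := β) (E := E) u v
  by_cases hE : E u v
  · by_cases hD : D u = D v
    · by_cases hH : EH β E u v
      · have := xval_le_keptWeight hrefl hH hD
        simpa [hE, hD, hH] using this
      · simp only [hE, hD, hH]; simp; linarith
    · simp [hE, hD]; linarith
  · simp only [hE]; simpa using h0

theorem sum_inv_Mdeg_le (hrefl : ∀ u, E u u) (hβ : β < 1) (hβ0 : 0 ≤ β) {u w : V}
    (h : EH β E u w) :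
    (∑ v, if EH β E w v ∧ ¬ E u v then (Mdeg E u v : ℝ)⁻¹ else 0) ≤ β / (1 - β) := by
  have hd : (0 : ℝ) < deg E u := Nat.cast_pos.2 (deg_pos hrefl u)
  have h1 : (∑ v, if EH β E w v ∧ ¬ E u v then (Mdeg E u v : ℝ)⁻¹ else 0)
      ≤ ((Nbr E w \ Nbr E u).card : ℝ) * (deg E u : ℝ)⁻¹ := by
    rw [Finset.cast_card, Finset.sum_mul, ← Finset.sum_filter]
    simp only [one_mul]
    refine (Finset.sum_le_sum fun v _ => inv_Mdeg_le_left hrefl u v).trans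
      (Finset.sum_le_sum_of_subset_of_nonneg (fun v hv => ?_) fun v _ _ => by positivity)
    simp only [Finset.mem_filter, Finset.mem_univ, true_and, Finset.mem_sdiff, mem_Nbr] at hv ⊢
    exact ⟨hv.1.1, hv.2⟩
  refine h1.trans ?_
  rw [← div_eq_mul_inv, div_le_div_iff₀ hd (by linarith)]
  have h2 : ((Nbr E w \ Nbr E u).card : ℝ) ≤ β * Mdeg E u w := by
    refine le_trans (Nat.cast_le.2 (Finset.card_le_card ?_)) h.2
    exact le_sup_right
  have h3 : (Mdeg E u w : ℝ) ≤ deg E u + (Nbr E w \ Nbr E u).card := by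
    have : Mdeg E u w ≤ deg E u + (Nbr E w \ Nbr E u).card := by
      refine max_le (Nat.le_add_right _ _) ?_
      have a := Finset.card_sdiff_add_card_inter (Nbr E w) (Nbr E u)
      have b := Finset.card_le_card (Finset.inter_subset_right (s₁ := Nbr E w) (s₂ := Nbr E u))
      simp only [deg]
      omega
    exact_mod_cast this
  nlinarith

theorem sum_indicator_inv_le_one (hrefl : ∀ u, E u u) (u : V) :
    (∑ v, if E u v then (deg E u : ℝ)⁻¹ else 0) ≤ 1 := by
  have hd : (0 : ℝ) < deg E u := Nat.cast_pos.2 (deg_pos hrefl u)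
  rw [← Finset.sum_filter, Finset.sum_const, nsmul_eq_mul]
  exact (mul_inv_cancel₀ hd.ne').le

theorem sum_kept_add_sum_pruned_le (hrefl : ∀ u, E u u) (u : V) :
    ∑ v, keptWeight β E D u v + ∑ v, prunedWeight β E D u v ≤ 1 := by
  rw [← Finset.sum_add_distrib]
  refine le_trans (Finset.sum_le_sum fun v _ => ?_) (sum_indicator_inv_le_one hrefl u)
  have h := inv_Mdeg_le_left hrefl u v
  have h0 : (0 : ℝ) ≤ (deg E u : ℝ)⁻¹ := by positivity
  unfold keptWeight prunedWeight
  by_cases hE : E u v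
  · by_cases hH : EH β E u v <;> by_cases hD : D u = D v <;> simp [hE, hH, hD, h]
  · have : ¬ EH β E u v := fun h => hE h.1
    simp [hE, this]

theorem sum_nonedge_le (hrefl : ∀ u, E u u) (hsymm : ∀ u v, E u v → E v u)
    (hβ : β < 1) (hβ0 : 0 ≤ β) (u : V) :
    (∑ v, if E u v then 0 else 1 - xval β E u v) ≤ missDeg E D u
      + β / (1 - β) * crossDeg E D u + ∑ w, triangleWeight β E D u w := by
  have h1 : (∑ v, if E u v then 0 else 1 - xval β E u v) =
      ∑ v, ∑ w, if ¬ E u v ∧ EH β E u w ∧ EH β E w v then (Mdeg E u v : ℝ)⁻¹ else 0 := by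
    refine Finset.sum_congr rfl fun v _ => ?_
    by_cases hE : E u v
    · simp [hE]
    · have huv : u ≠ v := by rintro rfl; exact hE (hrefl u)
      simp only [hE, if_false, xval, huv, not_false_iff, true_and, sub_sub_cancel]
      rw [← Finset.sum_filter, Finset.sum_const, nsmul_eq_mul, div_eq_mul_inv]
      congr 3
      ext w
      simp only [Finset.mem_inter, mem_NH, Finset.mem_filter, Finset.mem_univ, true_and]
      exact and_congr_right fun _ => ⟨EH_symm hsymm, EH_symm hsymm⟩
  have hA : (∑ v, ∑ w, if ¬ E u v ∧ D u = D v ∧ EH β E u w then (Mdeg E u v : ℝ)⁻¹ else 0)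
      ≤ missDeg E D u := by
    refine Finset.sum_le_sum fun v _ => ?_
    by_cases h : ¬ E u v ∧ D u = D v
    · rw [if_pos h]
      refine le_trans (Finset.sum_le_sum fun w _ => ?_) (sum_indicator_inv_le_one hrefl u)
      have h' := inv_Mdeg_le_left hrefl u v
      have h0 : (0 : ℝ) ≤ (deg E u : ℝ)⁻¹ := by positivity
      by_cases hH : EH β E u w
      · simpa [h.1, h.2, hH, hH.1] using h'
      · simp only [hH, and_false, if_false]; positivity
    · rw [if_neg h]
      refine (Finset.sum_eq_zero fun w _ => if_neg ?_).le
      tauto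
  have hB : (∑ w, ∑ v, if D u ≠ D w ∧ EH β E u w ∧ EH β E w v ∧ ¬ E u v
      then (Mdeg E u v : ℝ)⁻¹ else 0) ≤ β / (1 - β) * crossDeg E D u := by
    unfold crossDeg
    rw [Finset.mul_sum]
    have hκ : 0 ≤ β / (1 - β) := div_nonneg hβ0 (by linarith)
    refine Finset.sum_le_sum fun w _ => ?_
    by_cases h : D u ≠ D w ∧ EH β E u w
    · rw [if_pos ⟨h.2.1, h.1⟩, mul_one]
      simpa [h.1, h.2] using sum_inv_Mdeg_le hrefl hβ hβ0 h.2
    · refine (Finset.sum_eq_zero fun w _ => if_neg ?_).le.trans (by positivity)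
      tauto
  rw [h1]
  refine le_trans ?_ (add_le_add_left (add_le_add hA hB) _)
  rw [Finset.sum_comm (γ := V) (f := fun w v => if D u ≠ D w ∧ EH β E u w ∧ EH β E w v ∧ ¬ E u v
    then (Mdeg E u v : ℝ)⁻¹ else 0)]
  unfold triangleWeight
  rw [Finset.sum_comm (f := fun w v => if EH β E u w ∧ EH β E w v ∧ ¬ E u v ∧ D u = D w ∧
    D w ≠ D v then (Mdeg E u v : ℝ)⁻¹ else 0), ← Finset.sum_add_distrib,
    ← Finset.sum_add_distrib]
  refine Finset.sum_le_sum fun v _ => ?_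
  rw [← Finset.sum_add_distrib, ← Finset.sum_add_distrib]
  refine Finset.sum_le_sum fun w _ => ?_
  have h0 : (0 : ℝ) ≤ (Mdeg E u v : ℝ)⁻¹ := by positivity
  by_cases h : ¬ E u v ∧ EH β E u w ∧ EH β E w v
  · rw [if_pos h]
    obtain ⟨a, b, c⟩ := h
    by_cases hw : D u = D w
    · by_cases hv : D w = D v <;> simp [a, b, c, hw, hv]
    · simp only [a, b, c, hw]
      simp only [ne_eq, not_false_iff, true_and, and_true, false_and, and_false, if_false]
      split_ifs <;> linarith
  · rw [if_neg h]; positivity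

theorem mul_prunedDeg_le (hrefl : ∀ u, E u u) (u : V) :
    β * prunedDeg β E D u ≤ ∑ w, prunedWeight β E D u w * (costC E D u + costC E D w) := by
  simp only [prunedDeg, Finset.natCast_card_filter, Finset.mul_sum]
  refine Finset.sum_le_sum fun w _ => ?_
  unfold prunedWeight
  by_cases h : E u w ∧ ¬ EH β E u w ∧ D u = D w
  · rw [if_pos h, if_pos h, mul_one, inv_mul_eq_div, le_div_iff₀ (Mdeg_pos hrefl u w)]
    have h1 : β * Mdeg E u w < (symmDiff (Nbr E u) (Nbr E w)).card := by
      by_contra! h'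
      exact h.2.1 ⟨h.1, h'⟩
    have h2 : ((symmDiff (Nbr E u) (Nbr E w)).card : ℝ) ≤ costC E D u + costC E D w := by
      exact_mod_cast card_symmDiff_le hrefl h.2.2
    linarith
  · rw [if_neg h, if_neg h]; simp

theorem triangleWeight_le (hrefl : ∀ u, E u u) (u w : V) :
    triangleWeight β E D u w ≤ (if E u w then (deg E u : ℝ)⁻¹ else 0) * costC E D w := by
  by_cases h : EH β E u w
  · rw [if_pos h.1]
    refine le_trans ?_ (mul_le_mul_of_nonneg_left (crossDeg_le_cost hrefl w) (by positivity))
    unfold crossDeg triangleWeight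
    rw [Finset.mul_sum]
    refine Finset.sum_le_sum fun v _ => ?_
    have h0 : (0 : ℝ) ≤ (deg E u : ℝ)⁻¹ := by positivity
    by_cases h' : EH β E u w ∧ EH β E w v ∧ ¬ E u v ∧ D u = D w ∧ D w ≠ D v
    · rw [if_pos h', if_pos ⟨h'.2.1.1, h'.2.2.2.2⟩, mul_one]
      exact inv_Mdeg_le_left hrefl u v
    · rw [if_neg h']; positivity
  · have : triangleWeight β E D u w = 0 := Finset.sum_eq_zero fun v _ => if_neg (by tauto)
    rw [this]; positivity

theorem sum_triangleWeight_le (hrefl : ∀ u, E u u) (hsymm : ∀ u v, E u v → E v u)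
    (hβ : β < 1) (hβ0 : 0 ≤ β) (w : V) :
    ∑ u, triangleWeight β E D u w ≤ β / (1 - β) * costC E D w := by
  have hκ : 0 ≤ β / (1 - β) := div_nonneg hβ0 (by linarith)
  refine le_trans ?_ (mul_le_mul_of_nonneg_left (crossDeg_le_cost hrefl w) hκ)
  unfold triangleWeight crossDeg
  rw [Finset.sum_comm, Finset.mul_sum]
  refine Finset.sum_le_sum fun v _ => ?_
  by_cases h : EH β E w v ∧ D w ≠ D v
  · rw [if_pos ⟨h.1.1, h.2⟩, mul_one]
    refine le_trans (Finset.sum_le_sum fun u _ => ?_)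
      (sum_inv_Mdeg_le hrefl hβ hβ0 (EH_symm hsymm h.1))
    by_cases h' : EH β E u w ∧ EH β E w v ∧ ¬ E u v ∧ D u = D w ∧ D w ≠ D v
    · rw [if_pos h', if_pos ⟨EH_symm hsymm h'.1, fun h => h'.2.2.1 (hsymm _ _ h)⟩, Mdeg_comm]
    · rw [if_neg h']; positivity
  · refine (Finset.sum_eq_zero fun u _ => if_neg ?_).le.trans (by positivity)
    tauto

end Fractional

section Charging

variable {α : Type*} [Fintype V] {β : ℝ} {E : V → V → Prop} {D : V → α}

/-- The symmetric matrix distributing the pruned degrees over the disagreements. -/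
def prunedMatrix (β : ℝ) (E : V → V → Prop) (D : V → α) (u w : V) : ℝ :=
  (if u = w then ∑ v, prunedWeight β E D u v else 0) + prunedWeight β E D u w

/-- The matrix that charges the fractional cost to the disagreements of the clustering `D`. -/
def chargeMatrix (β : ℝ) (E : V → V → Prop) (D : V → α) (u w : V) : ℝ :=
  (if u = w then 2 + β / (1 - β) else 0) + keptWeight β E D u w
    + triangleWeight β E D u w / costC E D w
    + β⁻¹ * ((1 + ∑ v, keptWeight β E D u v) * prunedMatrix β E D u w
      + ∑ v, keptWeight β E D u v * prunedMatrix β E D v w)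

theorem prunedMatrix_nonneg (u w : V) : 0 ≤ prunedMatrix β E D u w := by
  have h := fun v => prunedWeight_nonneg (β := β) (E := E) (D := D) u v
  have h2 : 0 ≤ ∑ v, prunedWeight β E D u v := Finset.sum_nonneg fun v _ => h v
  unfold prunedMatrix
  exact add_nonneg (by positivity) (h w)

theorem chargeMatrix_nonneg (hβ : β < 1) (hβ0 : 0 ≤ β) (u w : V) :
    0 ≤ chargeMatrix β E D u w := by
  have hκ : 0 ≤ β / (1 - β) := div_nonneg hβ0 (by linarith)
  have h1 := fun u v => keptWeight_nonneg (β := β) (E := E) (D := D) u v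
  have h2 : 0 ≤ ∑ v, keptWeight β E D u v := Finset.sum_nonneg fun v _ => h1 u v
  have h3 := fun u v => prunedMatrix_nonneg (β := β) (E := E) (D := D) u v
  have h4 : 0 ≤ ∑ v, keptWeight β E D u v * prunedMatrix β E D v w :=
    Finset.sum_nonneg fun v _ => mul_nonneg (h1 u v) (h3 v w)
  have h5 := triangleWeight_nonneg (β := β) (E := E) (D := D) u w
  have h6 := h3 u w
  have h7 := h1 u w
  unfold chargeMatrix
  positivity

theorem sum_prunedMatrix_mul (u : V) (b : V → ℝ) :
    ∑ w, prunedMatrix β E D u w * b w = ∑ w, prunedWeight β E D u w * (b u + b w) := by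
  simp only [prunedMatrix, add_mul, mul_add, Finset.sum_add_distrib, ite_mul, zero_mul,
    Finset.sum_ite_eq, Finset.mem_univ, if_true, Finset.sum_mul]

theorem sum_prunedMatrix (u : V) :
    ∑ w, prunedMatrix β E D u w = 2 * ∑ w, prunedWeight β E D u w := by
  have h := sum_prunedMatrix_mul (β := β) (E := E) (D := D) u (fun _ => 1)
  simp only [mul_one] at h
  rw [h, ← Finset.sum_mul]; ring

theorem fractional_cost_le (hrefl : ∀ u, E u u) (hsymm : ∀ u v, E u v → E v u)
    (hβ : β < 1) (hβ0 : 0 < β) (u : V) :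
    (∑ v, if E u v then xval β E u v else 1 - xval β E u v)
      ≤ ∑ w, chargeMatrix β E D u w * costC E D w := by
  have split : (∑ v, if E u v then xval β E u v else 1 - xval β E u v)
      = (∑ v, if E u v then xval β E u v else 0)
        + ∑ v, if E u v then 0 else 1 - xval β E u v := by
    rw [← Finset.sum_add_distrib]
    refine Finset.sum_congr rfl fun v _ => ?_
    split_ifs <;> simp
  have h1 := sum_edge_le (β := β) (D := D) hrefl u
  have h2 := sum_nonedge_le (D := D) hrefl hsymm hβ hβ0.le u
  have hs : ∀ v, (prunedDeg β E D v : ℝ) ≤ β⁻¹ * ∑ w, prunedMatrix β E D v w * costC E D w := by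
    intro v
    rw [sum_prunedMatrix_mul, inv_mul_eq_div, le_div_iff₀ hβ0, mul_comm]
    exact mul_prunedDeg_le hrefl v
  have hN : ∀ w, triangleWeight β E D u w / costC E D w * costC E D w
      = triangleWeight β E D u w := by
    intro w
    by_cases h : (costC E D w : ℝ) = 0
    · have a := triangleWeight_le (β := β) (D := D) hrefl u w
      have b := triangleWeight_nonneg (β := β) (E := E) (D := D) u w
      rw [h, mul_zero] at a
      rw [h, mul_zero]; linarith
    · exact div_mul_cancel₀ _ h
  have hA : ∑ w, chargeMatrix β E D u w * costC E D w = (2 + β / (1 - β)) * costC E D u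
      + ∑ w, keptWeight β E D u w * costC E D w + ∑ w, triangleWeight β E D u w
      + ((1 + ∑ v, keptWeight β E D u v)
          * (β⁻¹ * ∑ w, prunedMatrix β E D u w * costC E D w)
        + ∑ v, keptWeight β E D u v
          * (β⁻¹ * ∑ w, prunedMatrix β E D v w * costC E D w)) := by
    simp only [chargeMatrix, add_mul _ _ (costC E D _ : ℝ), Finset.sum_add_distrib, hN]
    congr 1
    · simp; ring
    · simp only [Finset.mul_sum, Finset.sum_mul, mul_add, add_mul, Finset.sum_add_distrib]
      congr 1
      · congr 1
        · exact Finset.sum_congr rfl fun w _ => by ring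
        · exact Finset.sum_congr rfl fun w _ => Finset.sum_congr rfl fun v _ => by ring
      · rw [Finset.sum_comm]
        exact Finset.sum_congr rfl fun w _ => Finset.sum_congr rfl fun v _ => by ring
  have hπ := sum_kept_add_sum_pruned_le (β := β) (D := D) hrefl u
  have hτ : 0 ≤ ∑ v, prunedWeight β E D u v :=
    Finset.sum_nonneg fun v _ => prunedWeight_nonneg u v
  have hπ0 : 0 ≤ ∑ v, keptWeight β E D u v :=
    Finset.sum_nonneg fun v _ => keptWeight_nonneg u v
  have hK : ∑ v, keptWeight β E D u v *
        (costC E D u + costC E D v + (prunedDeg β E D u + prunedDeg β E D v))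
      = (∑ v, keptWeight β E D u v) * costC E D u + ∑ v, keptWeight β E D u v * costC E D v
        + (∑ v, keptWeight β E D u v) * prunedDeg β E D u
        + ∑ v, keptWeight β E D u v * prunedDeg β E D v := by
    simp only [mul_add, Finset.sum_add_distrib, Finset.sum_mul]; ring
  have hP : ∑ v, keptWeight β E D u v * (prunedDeg β E D v : ℝ) ≤ ∑ v, keptWeight β E D u v
          * (β⁻¹ * ∑ w, prunedMatrix β E D v w * costC E D w) :=
    Finset.sum_le_sum fun v _ => mul_le_mul_of_nonneg_left (hs v) (keptWeight_nonneg u v)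
  have hQ := mul_le_mul_of_nonneg_left (hs u) (add_nonneg zero_le_one hπ0)
  have hκ : 0 ≤ β / (1 - β) := div_nonneg hβ0.le (by linarith)
  have hc := cost_eq (D := D) hrefl u
  have hm := mul_le_mul_of_nonneg_left (crossDeg_le_cost (D := D) hrefl u) hκ
  have hk : (∑ v, keptWeight β E D u v) * costC E D u ≤ costC E D u :=
    mul_le_of_le_one_left (Nat.cast_nonneg _) (by linarith)
  rw [split, hA]
  rw [hK] at h1
  linarith

theorem chargeMatrix_row_sum_le (hrefl : ∀ u, E u u) (hβ0 : 0 < β) (u : V) :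
    ∑ w, chargeMatrix β E D u w ≤ 4 + β / (1 - β) + β⁻¹ * (5 / 2) := by
  have hN : ∑ w, triangleWeight β E D u w / costC E D w ≤ 1 := by
    refine (Finset.sum_le_sum fun w _ => ?_).trans (sum_indicator_inv_le_one hrefl u)
    exact div_le_of_le_mul₀ (Nat.cast_nonneg _) (by positivity) (triangleWeight_le hrefl u w)
  have hτ : ∀ v, ∑ w, prunedWeight β E D v w ≤ 1 := fun v => by
    have := sum_kept_add_sum_pruned_le (β := β) (D := D) hrefl v
    have hπ0 : 0 ≤ ∑ w, keptWeight β E D v w :=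
      Finset.sum_nonneg fun w _ => keptWeight_nonneg v w
    linarith
  have hP : ∑ v, keptWeight β E D u v * ∑ w, prunedMatrix β E D v w
      ≤ 2 * ∑ v, keptWeight β E D u v := by
    rw [Finset.mul_sum]
    refine Finset.sum_le_sum fun v _ => ?_
    rw [sum_prunedMatrix, mul_comm]
    exact mul_le_mul_of_nonneg_right (by linarith [hτ v]) (keptWeight_nonneg u v)
  have e : ∑ w, chargeMatrix β E D u w = 2 + β / (1 - β) + ∑ w, keptWeight β E D u w
      + ∑ w, triangleWeight β E D u w / costC E D w
      + β⁻¹ * ((1 + ∑ v, keptWeight β E D u v) * ∑ w, prunedMatrix β E D u w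
        + ∑ v, keptWeight β E D u v * ∑ w, prunedMatrix β E D v w) := by
    simp only [chargeMatrix, Finset.sum_add_distrib, ← Finset.mul_sum]
    rw [Finset.sum_comm (f := fun w v => keptWeight β E D u v * prunedMatrix β E D v w)]
    simp [← Finset.mul_sum]
  have hπ := sum_kept_add_sum_pruned_le (β := β) (D := D) hrefl u
  have hτ0 : 0 ≤ ∑ v, prunedWeight β E D u v :=
    Finset.sum_nonneg fun v _ => prunedWeight_nonneg u v
  have hπ0 : 0 ≤ ∑ v, keptWeight β E D u v :=
    Finset.sum_nonneg fun v _ => keptWeight_nonneg u v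
  rw [e, sum_prunedMatrix]
  generalize ∑ v, keptWeight β E D u v = π at *
  generalize ∑ v, prunedWeight β E D u v = τ at *
  have hq : (1 + π) * (2 * τ) + ∑ v, keptWeight β E D u v * ∑ w, prunedMatrix β E D v w
      ≤ 5 / 2 := by
    nlinarith [sq_nonneg (π - τ), mul_nonneg hπ0 hτ0]
  have := mul_le_mul_of_nonneg_left hq (inv_nonneg.2 hβ0.le)
  linarith

theorem chargeMatrix_col_sum_le (hrefl : ∀ u, E u u) (hsymm : ∀ u v, E u v → E v u)
    (hβ : β < 1) (hβ0 : 0 < β) (w : V) :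
    ∑ u, chargeMatrix β E D u w ≤ 3 + 2 * (β / (1 - β)) + β⁻¹ * 4 := by
  have hκ : 0 ≤ β / (1 - β) := div_nonneg hβ0.le (by linarith)
  have hN : ∑ u, triangleWeight β E D u w / costC E D w ≤ β / (1 - β) := by
    rw [← Finset.sum_div]
    exact div_le_of_le_mul₀ (Nat.cast_nonneg _) hκ (sum_triangleWeight_le hrefl hsymm hβ hβ0.le w)
  have hπ0 : ∀ u, 0 ≤ ∑ v, keptWeight β E D u v := fun u =>
    Finset.sum_nonneg fun v _ => keptWeight_nonneg u v
  have hτ0 : ∀ u, 0 ≤ ∑ v, prunedWeight β E D u v := fun u =>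
    Finset.sum_nonneg fun v _ => prunedWeight_nonneg u v
  have hπ := fun u => sum_kept_add_sum_pruned_le (β := β) (D := D) hrefl u
  have hK : ∑ u, keptWeight β E D u w = ∑ u, keptWeight β E D w u :=
    Finset.sum_congr rfl fun u _ => keptWeight_comm hsymm u w
  have hS : ∑ u, (1 + ∑ v, keptWeight β E D u v) * prunedMatrix β E D u w
      + ∑ u, ∑ v, keptWeight β E D u v * prunedMatrix β E D v w
      = ∑ u, (1 + 2 * ∑ v, keptWeight β E D u v) * prunedMatrix β E D u w := by
    rw [Finset.sum_comm, ← Finset.sum_add_distrib]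
    refine Finset.sum_congr rfl fun u _ => ?_
    rw [← Finset.sum_mul, Finset.sum_congr rfl fun v (_ : v ∈ Finset.univ) =>
      keptWeight_comm (β := β) (D := D) hsymm v u]
    ring
  have hS' : ∑ u, (1 + 2 * ∑ v, keptWeight β E D u v) * prunedMatrix β E D u w
      ≤ (1 + 2 * ∑ v, keptWeight β E D w v) * (∑ v, prunedWeight β E D w v)
        + 3 * ∑ v, prunedWeight β E D w v := by
    simp only [prunedMatrix, mul_add, Finset.sum_add_distrib, mul_ite, mul_zero,
      Finset.sum_ite_eq', Finset.mem_univ, if_true]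
    refine add_le_add le_rfl ?_
    rw [Finset.mul_sum]
    refine Finset.sum_le_sum fun u _ => ?_
    rw [prunedWeight_comm hsymm u w]
    exact mul_le_mul_of_nonneg_right (by linarith [hπ u, hτ0 u]) (prunedWeight_nonneg w u)
  have e : ∑ u, chargeMatrix β E D u w = 2 + β / (1 - β) + ∑ u, keptWeight β E D w u
      + ∑ u, triangleWeight β E D u w / costC E D w
      + β⁻¹ * ∑ u, (1 + 2 * ∑ v, keptWeight β E D u v) * prunedMatrix β E D u w := by
    rw [← hS, ← hK]
    simp only [chargeMatrix, Finset.sum_add_distrib, ← Finset.mul_sum]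
    simp
  rw [e]
  have hπw := hπ w
  have hπ0w := hπ0 w
  have hτ0w := hτ0 w
  generalize ∑ v, keptWeight β E D w v = π at *
  generalize ∑ v, prunedWeight β E D w v = τ at *
  have hq : ∑ u, (1 + 2 * ∑ v, keptWeight β E D u v) * prunedMatrix β E D u w ≤ 4 := by
    refine hS'.trans ?_
    nlinarith
  have := mul_le_mul_of_nonneg_left hq (inv_nonneg.2 hβ0.le)
  linarith

end Charging

/-- Every correlation clustering instance admits a single
clustering `𝒞` that is simultaneously a `63.3`-approximation for all monotone
symmetric norms: for every such norm `f` and every clustering `D` (in particular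
`D = OPT_f`), `f(cost_𝒞) ≤ 63.3 · f(cost_D)`. -/
theorem exists_simultaneous_approx [Fintype V] (E : V → V → Prop)
    (hsymm : ∀ u v, E u v → E v u) (hrefl : ∀ u, E u u) :
    ∃ C : V → ℕ, ∀ f : (V → ℝ) → ℝ, IsMonoSymNorm f → ∀ D : V → ℕ,
      f (fun u => (costC E C u : ℝ)) ≤ 63.3 * f (fun u => (costC E D u : ℝ)) := by
  obtain ⟨C, hC⟩ := exists_rounding E (xval (7 / 12) E) xval_self xval_comm xval_nonneg
    xval_le_one (xval_triangle hrefl) hrefl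
  refine ⟨C, fun f hf D => ?_⟩
  have hβ : (7 / 12 : ℝ) < 1 := by norm_num
  have hβ0 : (0 : ℝ) < 7 / 12 := by norm_num
  refine hf.map_le_of_row_col_sum_le (by norm_num)
    (fun u w => 5 * chargeMatrix (7 / 12) E D u w) (fun u w => ?_) (fun u => ?_) (fun w => ?_)
    _ _ (fun u => Nat.cast_nonneg _) (fun u => Nat.cast_nonneg _) (fun u => ?_)
  · exact mul_nonneg (by norm_num) (chargeMatrix_nonneg hβ hβ0.le u w)
  · have h := chargeMatrix_row_sum_le (D := D) hrefl hβ0 u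
    rw [← Finset.mul_sum]
    norm_num at h ⊢
    linarith
  · have h := chargeMatrix_col_sum_le (D := D) hrefl hsymm hβ hβ0 w
    rw [← Finset.mul_sum]
    norm_num at h ⊢
    linarith
  · have h := fractional_cost_le (D := D) hrefl hsymm hβ hβ0 u
    simp only [mul_assoc, ← Finset.mul_sum]
    linarith [hC u]

end
end

section
/- Let G=(V,E) be a correlation clustering instance and let ε∈(0,1] with ε ≤ 1/20. Let (x_{uv})_{u,v∈V} be symmetric values in [0,1] with x_{uu}=0 satisfying the approximate triangle inequality x_{uv}+x_{uw}+ε ≥ x_{vw} for all u,v,w∈V. For each u∈V let y_u = Σ_{v : uv∈E} x_{uv} + Σ_{v≠u, uv∉E} (1−x_{uv}) be the fractional (LP) disagreement of u. Then there exists a clustering 𝒞 of V such that for every u∈V, cost_𝒞(u) ≤ (5+55ε)·y_u. -/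
open Finset

attribute [local instance] Classical.propDecidable

noncomputable section

variable {V : Type*}

/-- The fractional disagreement of the pair `uv`. -/
def lpCost (E : V → V → Prop) (x : V → V → ℝ) (u v : V) : ℝ :=
  if E u v then x u v else 1 - x u v

/-- The indicator that the pair `uv` is in disagreement with respect to `C`. -/
def disagree {α : Type*} (E : V → V → Prop) (C : V → α) (u v : V) : ℝ :=
  if (E u v ∧ C u ≠ C v) ∨ (¬ E u v ∧ v ≠ u ∧ C u = C v) then 1 else 0

/-- The profit of the pair `uv`, with profit parameter `r`, when the ball of radius `R` around `w`
is removed as a cluster. -/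
def ballProfit (E : V → V → Prop) (x : V → V → ℝ) (r R : ℝ) (w u v : V) : ℝ :=
  if x w u ≤ R ∨ x w v ≤ R then
    lpCost E x u v - r * (if E u v ↔ ¬ (x w u ≤ R ∧ x w v ≤ R) then 1 else 0)
  else 0

/-- A vertex far from the boundary of the ball around `w` has no pair of negative profit. -/
lemma ballProfit_nonneg {E : V → V → Prop} {x : V → V → ℝ} {ε r R : ℝ}
    (hxsymm : ∀ u v, x u v = x v u) (hx0 : ∀ u v, 0 ≤ x u v) (hx1 : ∀ u v, x u v ≤ 1)
    (htri : ∀ u v w : V, x v w ≤ x u v + x u w + ε)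
    (hR : 2 * R + ε + r ≤ 1) {w u : V}
    (hu : x w u ≤ R - r - ε ∨ R + r + ε ≤ x w u) (v : V) :
    0 ≤ ballProfit E x r R w u v := by
  have h0 := hx0 u v
  have h1 := hx1 u v
  have t1 := htri w u v
  have t2 := htri u w v
  have t3 := htri v w u
  rw [hxsymm u w] at t2
  rw [hxsymm v w, hxsymm v u] at t3
  unfold ballProfit lpCost
  by_cases hE : E u v <;> by_cases ha : x w u ≤ R <;> by_cases hb : x w v ≤ R <;>
    simp only [hE, ha, hb, and_self, or_self, and_true, and_false, or_true,
      or_false, not_true, not_false_eq_true, iff_true, iff_false, if_true, if_false,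
      mul_one, mul_zero, sub_zero, le_refl] <;>
    rcases hu with hu | hu <;> linarith

/-- A vertex near the boundary of the ball around `w` gains from the vertices close to `w` and
loses at most from the vertices close to itself. -/
lemma sub_le_ballProfit {E : V → V → Prop} {x : V → V → ℝ} {ε r R : ℝ}
    (hxsymm : ∀ u v, x u v = x v u) (hx0 : ∀ u v, 0 ≤ x u v) (hx1 : ∀ u v, x u v ≤ 1)
    (htri : ∀ u v w : V, x v w ≤ x u v + x u w + ε) (hε : 0 ≤ ε) (hr : 0 ≤ r)
    (hrR : 2 * r + 2 * ε ≤ R) (hR : 2 * R + ε + r ≤ 1) {w u : V}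
    (hu₁ : R - r - ε < x w u) (hu₂ : x w u < R + r + ε) (v : V) :
    max (r - x w v) 0 - max (r - x u v) 0 ≤ ballProfit E x r R w u v := by
  have h0 := hx0 u v
  have h1 := hx1 u v
  have t1 := htri w u v
  have t3 := htri v w u
  rw [hxsymm v w, hxsymm v u] at t3
  have m1 := le_max_left (r - x u v) 0
  have m2 := le_max_right (r - x u v) 0
  unfold ballProfit lpCost
  by_cases hE : E u v <;> by_cases ha : x w u ≤ R <;> by_cases hb : x w v ≤ R <;>
    simp only [hE, ha, hb, and_self, or_self, and_true, and_false, or_true,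
      or_false, not_true, not_false_eq_true, iff_true, iff_false, if_true, if_false,
      mul_one, mul_zero, sub_zero] <;>
    rcases max_cases (r - x w v) 0 with ⟨h, h'⟩ | ⟨h, h'⟩ <;> rw [h] <;> linarith

/-- Removing the ball around a vertex `w` of maximal weight makes a nonnegative profit at every
vertex. -/
lemma sum_ballProfit_nonneg {E : V → V → Prop} {x : V → V → ℝ} {ε r R : ℝ}
    (hxsymm : ∀ u v, x u v = x v u) (hx0 : ∀ u v, 0 ≤ x u v) (hx1 : ∀ u v, x u v ≤ 1)
    (htri : ∀ u v w : V, x v w ≤ x u v + x u w + ε) (hε : 0 ≤ ε) (hr : 0 ≤ r)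
    (hrR : 2 * r + 2 * ε ≤ R) (hR : 2 * R + ε + r ≤ 1) {S : Finset V} {w u : V}
    (hw : ∑ v ∈ S, max (r - x u v) 0 ≤ ∑ v ∈ S, max (r - x w v) 0) :
    0 ≤ ∑ v ∈ S, ballProfit E x r R w u v := by
  by_cases hu : x w u ≤ R - r - ε ∨ R + r + ε ≤ x w u
  · exact sum_nonneg fun v _ => ballProfit_nonneg hxsymm hx0 hx1 htri hR hu v
  · push Not at hu
    calc 0 ≤ ∑ v ∈ S, (max (r - x w v) 0 - max (r - x u v) 0) := by
          rw [sum_sub_distrib]; linarith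
      _ ≤ _ := sum_le_sum fun v _ =>
          sub_le_ballProfit hxsymm hx0 hx1 htri hε hr hrR hR hu.1 hu.2 v

/-- Greedy ball growing on a finite set `S` of vertices. -/
lemma exists_rounding_on_s15 {E : V → V → Prop} (hrefl : ∀ u, E u u) {x : V → V → ℝ} {ε r R : ℝ}
    (hxsymm : ∀ u v, x u v = x v u) (hx0 : ∀ u v, 0 ≤ x u v) (hx1 : ∀ u v, x u v ≤ 1)
    (hxdiag : ∀ u, x u u = 0)
    (htri : ∀ u v w : V, x v w ≤ x u v + x u w + ε) (hε : 0 ≤ ε) (hr : 0 ≤ r)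
    (hrR : 2 * r + 2 * ε ≤ R) (hR : 2 * R + ε + r ≤ 1) (S : Finset V) :
    ∃ C : V → ℕ, ∀ u ∈ S, 0 ≤ ∑ v ∈ S, (lpCost E x u v - r * disagree E C u v) := by
  induction S using Finset.strongInduction with
  | H S ih =>
  rcases S.eq_empty_or_nonempty with rfl | hS
  · exact ⟨fun _ => 0, by simp⟩
  obtain ⟨w, hwS, hw⟩ := S.exists_max_image (fun u => ∑ v ∈ S, max (r - x u v) 0) hS
  have hsub : S.filter (fun v => ¬ x w v ≤ R) ⊂ S :=
    filter_ssubset.2 ⟨w, hwS, by rw [hxdiag]; push Not; linarith⟩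
  obtain ⟨C, hC⟩ := ih _ hsub
  refine ⟨fun v => if x w v ≤ R then 0 else C v + 1, fun u hu => ?_⟩
  set D : V → ℕ := fun v => if x w v ≤ R then 0 else C v + 1 with hD
  have hstep := sum_ballProfit_nonneg (E := E) hxsymm hx0 hx1 htri hε hr hrR hR (hw u hu)
  have hcut : ∀ v, x w u ≤ R ∨ x w v ≤ R →
      lpCost E x u v - r * disagree E D u v = ballProfit E x r R w u v := by
    intro v h
    have hne : ¬ E u v → v ≠ u := fun h h' => h (h' ▸ hrefl u)
    unfold ballProfit disagree
    rw [if_pos h]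
    congr 3
    by_cases hE : E u v <;> by_cases ha : x w u ≤ R <;> by_cases hb : x w v ≤ R <;>
      simp_all
  by_cases hu' : x w u ≤ R
  · rwa [sum_congr rfl fun v _ => hcut v (Or.inl hu')]
  · rw [← sum_filter_add_sum_filter_not S (fun v => x w v ≤ R)] at hstep ⊢
    have hin : ∑ v ∈ S with x w v ≤ R, (lpCost E x u v - r * disagree E D u v) =
        ∑ v ∈ S with x w v ≤ R, ballProfit E x r R w u v :=
      sum_congr rfl fun v hv => hcut v (Or.inr (mem_filter.1 hv).2)
    have hzero : ∑ v ∈ S with ¬ x w v ≤ R, ballProfit E x r R w u v = 0 :=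
      sum_eq_zero fun v hv => by
        rw [ballProfit, if_neg (not_or.2 ⟨hu', (mem_filter.1 hv).2⟩)]
    have hout : ∑ v ∈ S with ¬ x w v ≤ R, (lpCost E x u v - r * disagree E D u v) =
        ∑ v ∈ S with ¬ x w v ≤ R, (lpCost E x u v - r * disagree E C u v) :=
      sum_congr rfl fun v hv => by
        have hv' := (mem_filter.1 hv).2
        have heq : disagree E D u v = disagree E C u v := by
          unfold disagree
          congr 1
          simp only [hD, if_neg hu', if_neg hv', ne_eq, Nat.add_right_cancel_iff]
        rw [heq]
    have := hC u (mem_filter.2 ⟨hu, hu'⟩)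
    linarith

/-- Given LP values `x` in `[0,1]` with `x_{uu} = 0` satisfying the
approximate triangle inequality `x_{uv} + x_{uw} + ε ≥ x_{vw}`, there is a clustering
`𝒞` whose disagreement at each vertex `u` is at most `(5 + 55ε)` times the fractional
disagreement `y_u` of `u`. -/
theorem exists_per_vertex_rounding [Fintype V] (E : V → V → Prop)
    (hsymm : ∀ u v, E u v → E v u) (hrefl : ∀ u, E u u)
    (ε : ℝ) (hε0 : 0 < ε) (hε1 : ε ≤ 1 / 20)
    (x : V → V → ℝ) (hxsymm : ∀ u v, x u v = x v u)
    (hx0 : ∀ u v, 0 ≤ x u v) (hx1 : ∀ u v, x u v ≤ 1)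
    (hxdiag : ∀ u, x u u = 0)
    (htri : ∀ u v w : V, x v w ≤ x u v + x u w + ε) :
    ∃ C : V → ℕ, ∀ u : V,
      (costC E C u : ℝ) ≤ (5 + 55 * ε) *
        ((∑ v ∈ Finset.univ.filter (fun v => E u v), x u v)
          + ∑ v ∈ Finset.univ.filter (fun v => v ≠ u ∧ ¬ E u v), (1 - x u v)) := by
  obtain ⟨C, hC⟩ := exists_rounding_on_s15 (r := 1 / 5 - ε) (R := 2 / 5) hrefl hxsymm hx0 hx1 hxdiag
    htri hε0.le (by linarith) (by linarith) (by linarith) Finset.univ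
  refine ⟨C, fun u => ?_⟩
  have hcost : ∑ v, disagree E C u v = (costC E C u : ℝ) := by
    simp only [disagree, costC]
    convert sum_boole _ _
  have hlp : ∑ v, lpCost E x u v = (∑ v ∈ Finset.univ.filter (fun v => E u v), x u v)
      + ∑ v ∈ Finset.univ.filter (fun v => v ≠ u ∧ ¬ E u v), (1 - x u v) := by
    have hne : ∀ v, (v ≠ u ∧ ¬ E u v) ↔ ¬ E u v := fun v =>
      and_iff_right_of_imp fun h h' => h (h' ▸ hrefl u)
    simp only [lpCost, sum_ite, hne]
  have h := hC u (mem_univ u)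
  rw [sum_sub_distrib, ← mul_sum, hcost, hlp] at h
  have hpar : 1 ≤ (5 + 55 * ε) * (1 / 5 - ε) := by nlinarith
  calc (costC E C u : ℝ) ≤ (5 + 55 * ε) * (1 / 5 - ε) * costC E C u :=
        le_mul_of_one_le_left (Nat.cast_nonneg _) hpar
    _ = (5 + 55 * ε) * ((1 / 5 - ε) * costC E C u) := mul_assoc _ _ _
    _ ≤ _ := mul_le_mul_of_nonneg_left (by linarith) (by linarith)

end
end
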